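/- arXiv:1411.5953 — 6 statements merged into one kernel-verified Lean document; each statement's English description precedes it below -/
import Mathlib

section
/- If ū : P → H is a dressing field and π is surjective, then the map φ : P → M×H defined by φ(p) := (π(p), ū(p)⁻¹) is a trivialization of P: it is a bijection, satisfies φ(p·h) = φ(p)·h for all p, h, and its first component equals π. (In particular, the existence of a dressing field implies that P is a trivial bundle.) -/
/-- If `ū : P → H` is a dressing field and `π` is surjective, then
`φ p := (π p, (ū p)⁻¹)` is a trivialization of `P`: a bijection onto `M × H` which is
`H`-equivariant and whose first component is `π`.  In particular the existence of a
dressing field implies that `P` is a trivial bundle. -/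
theorem dressing_field_gives_trivialization
    {H M P : Type*} [Group H]
    (act : P → H → P) (π : P → M)
    (act_one : ∀ p, act p 1 = p)
    (act_mul : ∀ p h h', act (act p h) h' = act p (h * h'))
    (hπ : ∀ p h, π (act p h) = π p)
    (hfree : ∀ p h, act p h = p → h = 1)
    (htrans : ∀ p q, π p = π q → ∃ h, q = act p h)
    (u : P → H)
    (hu : ∀ p h, u (act p h) = h⁻¹ * u p)
    (hsurj : Function.Surjective π) :
    Function.Bijective (fun p => ((π p, (u p)⁻¹) : M × H))
      ∧ (∀ p h, ((π (act p h), (u (act p h))⁻¹) : M × H) = (π p, (u p)⁻¹ * h))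
      ∧ ∀ p, (((π p, (u p)⁻¹) : M × H)).1 = π p := by
  refine ⟨⟨?_, ?_⟩, ?_, fun _ => rfl⟩
  · intro p q hpq
    obtain ⟨h1, h2⟩ := Prod.mk.inj hpq
    obtain ⟨h, rfl⟩ := htrans p q h1
    have h3 : h = 1 := by
      rw [hu] at h2
      simpa using h2
    rw [h3, act_one]
  · rintro ⟨x, k⟩
    obtain ⟨p, rfl⟩ := hsurj x
    refine ⟨act p (u p * k), ?_⟩
    simp [hπ, hu]
  · intro p h
    simp [hπ, hu]
end

section
/- Let u : E → M_m be twice continuously differentiable with u(x) invertible for every x, and such that the pointwise inverse map x ↦ (u x)⁻¹ is twice continuously differentiable. Then the pure-gauge potential A_u(x)v := (u x) * (fderiv ℝ (fun y => (u y)⁻¹) x v) is flat: its curvature vanishes, F_{A_u}(x)(v,w) = 0 for all x ∈ E and v, w ∈ E. -/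
attribute [local instance] Matrix.linftyOpNormedRing Matrix.linftyOpNormedAlgebra

theorem flat_aux {R : Type*} [NormedRing R] [NormedAlgebra ℝ R]
    {E : Type*} [NormedAddCommGroup E] [NormedSpace ℝ E]
    (u g : E → R) (hu : ContDiff ℝ 2 u) (hg : ContDiff ℝ 2 g)
    (h1 : ∀ x, u x * g x = 1) (h2 : ∀ x, g x * u x = 1)
    (A : E → (E →L[ℝ] R)) (hA : ∀ x v, A x v = u x * (fderiv ℝ g x v)) (x v w : E) :
    (fderiv ℝ A x v) w - (fderiv ℝ A x w) v + (A x v) * (A x w) - (A x w) * (A x v) = 0 := by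
  have du : Differentiable ℝ u := hu.differentiable (by norm_num)
  have dg : Differentiable ℝ g := hg.differentiable (by norm_num)
  have dG : Differentiable ℝ (fderiv ℝ g) :=
    (hg.fderiv_right (m := 1) (by norm_num)).differentiable (by norm_num)
  have eA : A = fun y => (ContinuousLinearMap.mul ℝ R (u y)).comp (fderiv ℝ g y) := by
    funext y
    ext z
    simp [hA]
  have dA : Differentiable ℝ A := by
    rw [eA]
    exact ((ContinuousLinearMap.mul ℝ R).differentiable.comp du).clm_comp dG
  have key : ∀ a b, (fderiv ℝ A x a) b
      = fderiv ℝ u x a * fderiv ℝ g x b + u x * (fderiv ℝ (fderiv ℝ g) x a) b := by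
    intro a b
    have e1 : HasFDerivAt (fun y => A y b) ((fderiv ℝ A x).flip b) x := by
      simpa using (dA x).hasFDerivAt.clm_apply (hasFDerivAt_const b x)
    have e2 : HasFDerivAt (fun y => fderiv ℝ g y b) ((fderiv ℝ (fderiv ℝ g) x).flip b) x := by
      simpa using (dG x).hasFDerivAt.clm_apply (hasFDerivAt_const b x)
    have e3 := (du x).hasFDerivAt.mul' e2
    have e4 : (fun y => A y b) = u * fun y => fderiv ℝ g y b := funext fun y => hA y b
    rw [e4] at e1
    have := congrArg (fun L => L a) (e1.unique e3)
    simpa [add_comm] using this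
  have sym : (fderiv ℝ (fderiv ℝ g) x v) w = (fderiv ℝ (fderiv ℝ g) x w) v :=
    (hg.contDiffAt.isSymmSndFDerivAt (by simp)) v w
  have inv : ∀ a, u x * fderiv ℝ g x a * u x = - fderiv ℝ u x a := by
    intro a
    have e3 := (du x).hasFDerivAt.mul' (dg x).hasFDerivAt
    have e4 : u * g = fun _ => (1 : R) := funext h1
    rw [e4] at e3
    have h := congrArg (fun L => L a) (e3.unique (hasFDerivAt_const (1 : R) x))
    have h' : u x * fderiv ℝ g x a + fderiv ℝ u x a * g x = 0 := by simpa using h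
    rw [eq_neg_of_add_eq_zero_left h', neg_mul, mul_assoc, h2, mul_one]
  rw [key, key, sym, hA, hA, ← mul_assoc, ← mul_assoc, inv, inv]
  noncomm_ring

/-- If `u : E → M_m` is `C²` with `u x` invertible for every `x` and
with `x ↦ (u x)⁻¹` also `C²`, then the pure-gauge potential
`A_u x v := u x * (fderiv ℝ (fun y => (u y)⁻¹) x v)` is flat: its curvature
`F_{A_u} x (v, w)` vanishes for all `x, v, w`. -/
theorem pure_gauge_potential_is_flat
    {E : Type*} [NormedAddCommGroup E] [NormedSpace ℝ E]
    {m : ℕ} (hm : 0 < m)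
    (u : E → Matrix (Fin m) (Fin m) ℝ)
    (hu : ContDiff ℝ 2 u)
    (hunit : ∀ x, IsUnit (u x))
    (huinv : ContDiff ℝ 2 (fun y => (u y)⁻¹))
    (A : E → (E →L[ℝ] Matrix (Fin m) (Fin m) ℝ))
    (hA : ∀ x v, A x v = u x * (fderiv ℝ (fun y => (u y)⁻¹) x v)) :
    ∀ (x v w : E),
      (fderiv ℝ A x v) w - (fderiv ℝ A x w) v + (A x v) * (A x w) - (A x w) * (A x v)
        = 0 := by
  intro x v w
  exact flat_aux u (fun y => (u y)⁻¹) hu huinv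
    (fun x => Matrix.mul_nonsing_inv _ ((Matrix.isUnit_iff_isUnit_det _).1 (hunit x)))
    (fun x => Matrix.nonsing_inv_mul _ ((Matrix.isUnit_iff_isUnit_det _).1 (hunit x))) A hA x v w
end

section
/- Let A : E → (E →L[ℝ] M_m) be a continuously differentiable gauge potential and γ : E → M_m a twice continuously differentiable map with γ(x) invertible for every x and with x ↦ (γ x)⁻¹ twice continuously differentiable. Define the gauge-transformed potential A^γ(x)v := (γ x)⁻¹ * (A x v) * (γ x) + (γ x)⁻¹ * (fderiv ℝ γ x v). Then the curvature transforms covariantly: F_{A^γ}(x)(v,w) = (γ x)⁻¹ * F_A(x)(v,w) * (γ x) for all x, v, w. -/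
attribute [local instance] Matrix.linftyOpNormedRing Matrix.linftyOpNormedAlgebra
attribute [-instance] instTopologicalSpaceMatrix Matrix.instUniformSpace

theorem aux_cov {E R : Type*} [NormedAddCommGroup E] [NormedSpace ℝ E]
    [NormedRing R] [NormedAlgebra ℝ R]
    (A : E → (E →L[ℝ] R)) (hA : ContDiff ℝ 1 A)
    (γ g : E → R) (hγ : ContDiff ℝ 2 γ) (hg : ContDiff ℝ 2 g)
    (h1 : ∀ x, g x * γ x = 1) (h2 : ∀ x, γ x * g x = 1)
    (B : E → (E →L[ℝ] R))
    (hB : ∀ x v, B x v = g x * (A x v) * γ x + g x * (fderiv ℝ γ x v)) (x v w : E) :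
    (fderiv ℝ B x v) w - (fderiv ℝ B x w) v + (B x v) * (B x w) - (B x w) * (B x v)
      = g x * ((fderiv ℝ A x v) w - (fderiv ℝ A x w) v + (A x v) * (A x w) - (A x w) * (A x v))
          * γ x := by
  have dA : Differentiable ℝ A := hA.differentiable (by norm_num)
  have dγ : Differentiable ℝ γ := hγ.differentiable (by norm_num)
  have dg : Differentiable ℝ g := hg.differentiable (by norm_num)
  have dγ2 : Differentiable ℝ (fderiv ℝ γ) :=
    (hγ.fderiv_right (m := 1) (by norm_num)).differentiable (by norm_num)
  have eB : B = fun y => (ContinuousLinearMap.mul ℝ R (g y)).comp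
      (((ContinuousLinearMap.mul ℝ R).flip (γ y)).comp (A y))
      + (ContinuousLinearMap.mul ℝ R (g y)).comp (fderiv ℝ γ y) := by
    funext y
    ext u
    simp [hB, mul_assoc]
  have dB : Differentiable ℝ B := by
    have e1 : Differentiable ℝ fun y => ContinuousLinearMap.mul ℝ R (g y) :=
      (ContinuousLinearMap.mul ℝ R).differentiable.comp dg
    have e2 : Differentiable ℝ fun y => (ContinuousLinearMap.mul ℝ R).flip (γ y) :=
      (ContinuousLinearMap.mul ℝ R).flip.differentiable.comp dγ
    rw [eB]
    exact (e1.clm_comp (e2.clm_comp dA)).add (e1.clm_comp dγ2)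
  have ev : ∀ (C : E → (E →L[ℝ] R)), Differentiable ℝ C → ∀ u : E,
      HasFDerivAt (fun y => C y u) ((fderiv ℝ C x).flip u) x := by
    intro C hC u
    simpa using (hC x).hasFDerivAt.clm_apply (hasFDerivAt_const u x)
  have hg' := (dg x).hasFDerivAt
  have hγ' := (dγ x).hasFDerivAt
  have hDg : ∀ u, fderiv ℝ g x u = - (g x * fderiv ℝ γ x u * g x) := by
    intro u
    have k := hg'.mul' hγ'
    have k0 : HasFDerivAt (g * γ) (0 : E →L[ℝ] R) x := by
      have : g * γ = fun _ => (1 : R) := funext h1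
      rw [this]
      exact hasFDerivAt_const _ _
    have k1 := congrArg (fun L : E →L[ℝ] R => L u * g x) (k.unique k0)
    simp [add_mul, mul_assoc, h2] at k1
    rw [mul_assoc]
    exact eq_neg_of_add_eq_zero_right k1
  have key : ∀ u z, fderiv ℝ B x u z =
      -(g x * fderiv ℝ γ x u * g x) * A x z * γ x + g x * (fderiv ℝ A x u z) * γ x
      + g x * A x z * fderiv ℝ γ x u - g x * fderiv ℝ γ x u * g x * fderiv ℝ γ x z
      + g x * fderiv ℝ (fderiv ℝ γ) x u z := by
    intro u z
    have k1 := ev B dB z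
    have k2 := ((hg'.mul' (ev A dA z)).mul' hγ').add (hg'.mul' (ev _ dγ2 z))
    have e : (fun y => B y z) = (g * (fun y => A y z)) * γ + g * (fun y => fderiv ℝ γ y z) := by
      funext y
      simp [hB]
    rw [e] at k1
    have k3 := congrArg (fun L : E →L[ℝ] R => L u) (k1.unique k2)
    simp [hDg] at k3
    rw [k3]
    noncomm_ring
  have hs : fderiv ℝ (fderiv ℝ γ) x v w = fderiv ℝ (fderiv ℝ γ) x w v :=
    (hγ.contDiffAt.isSymmSndFDerivAt (by simp)) v w
  have c : ∀ r, γ x * (g x * r) = r := fun r => by rw [← mul_assoc, h2, one_mul]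
  rw [key, key, hs, hB, hB]
  simp only [mul_add, add_mul, mul_sub, sub_mul, mul_assoc, neg_mul, c]
  abel

/-- If `A` is a `C¹` gauge potential and `γ : E → M_m` is `C²` with
pointwise invertible values and `C²` pointwise inverse, then the curvature of the
gauge-transformed potential `A^γ x v := (γ x)⁻¹ * (A x v) * γ x + (γ x)⁻¹ * fderiv ℝ γ x v`
transforms covariantly: `F_{A^γ} x (v, w) = (γ x)⁻¹ * F_A x (v, w) * γ x`. -/
theorem curvature_transforms_covariantly
    {E : Type*} [NormedAddCommGroup E] [NormedSpace ℝ E]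
    {m : ℕ} (hm : 0 < m)
    (A : E → (E →L[ℝ] Matrix (Fin m) (Fin m) ℝ))
    (hA : ContDiff ℝ 1 A)
    (γ : E → Matrix (Fin m) (Fin m) ℝ)
    (hγ : ContDiff ℝ 2 γ)
    (hγunit : ∀ x, IsUnit (γ x))
    (hγinv : ContDiff ℝ 2 (fun y => (γ y)⁻¹))
    (Aγ : E → (E →L[ℝ] Matrix (Fin m) (Fin m) ℝ))
    (hAγ : ∀ x v, Aγ x v = (γ x)⁻¹ * (A x v) * γ x + (γ x)⁻¹ * (fderiv ℝ γ x v)) :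
    ∀ (x v w : E),
      (fderiv ℝ Aγ x v) w - (fderiv ℝ Aγ x w) v + (Aγ x v) * (Aγ x w) - (Aγ x w) * (Aγ x v)
        = (γ x)⁻¹ *
            ((fderiv ℝ A x v) w - (fderiv ℝ A x w) v + (A x v) * (A x w) - (A x w) * (A x v))
          * γ x := by
  intro x v w
  have hd : ∀ x, IsUnit (γ x).det := fun x => (Matrix.isUnit_iff_isUnit_det _).1 (hγunit x)
  exact aux_cov A hA γ (fun y => (γ y)⁻¹) hγ hγinv
    (fun x => Matrix.nonsing_inv_mul _ (hd x)) (fun x => Matrix.mul_nonsing_inv _ (hd x))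
    Aγ hAγ x v w
end

section
/- Let A : E → (E →L[ℝ] M_m) be a gauge potential and u, γ : E → M_m differentiable maps with u(x) and γ(x) invertible for every x. Define the gauge transforms A^γ(x)v := (γ x)⁻¹ * (A x v) * (γ x) + (γ x)⁻¹ * (fderiv ℝ γ x v) and u^γ(x) := (γ x)⁻¹ * (u x). Then the dressing of A^γ by u^γ equals the dressing of A by u: (u^γ x)⁻¹ * (A^γ x v) * (u^γ x) + (u^γ x)⁻¹ * (fderiv ℝ u^γ x v) = (u x)⁻¹ * (A x v) * (u x) + (u x)⁻¹ * (fderiv ℝ u x v) for all x, v. That is, the dressed potential Â is gauge invariant. -/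
attribute [local instance] Matrix.linftyOpNormedRing Matrix.linftyOpNormedAlgebra

/-- Let `A` be a gauge potential and `u, γ : E → M_m` differentiable
maps with pointwise invertible values.  With the gauge transforms
`A^γ x v := (γ x)⁻¹ * (A x v) * γ x + (γ x)⁻¹ * fderiv ℝ γ x v` and
`u^γ x := (γ x)⁻¹ * u x`, the dressing of `A^γ` by `u^γ` equals the dressing of `A`
by `u`: the dressed potential `Â` is gauge invariant. -/
theorem dressed_potential_is_gauge_invariant
    {E : Type*} [NormedAddCommGroup E] [NormedSpace ℝ E]
    {m : ℕ} (hm : 0 < m)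
    (A : E → (E →L[ℝ] Matrix (Fin m) (Fin m) ℝ))
    (u γ : E → Matrix (Fin m) (Fin m) ℝ)
    (hu : Differentiable ℝ u) (hγ : Differentiable ℝ γ)
    (huunit : ∀ x, IsUnit (u x)) (hγunit : ∀ x, IsUnit (γ x)) :
    ∀ (x v : E),
      ((γ x)⁻¹ * u x)⁻¹ * ((γ x)⁻¹ * (A x v) * γ x + (γ x)⁻¹ * (fderiv ℝ γ x v))
          * ((γ x)⁻¹ * u x)
        + ((γ x)⁻¹ * u x)⁻¹ * (fderiv ℝ (fun y => (γ y)⁻¹ * u y) x v)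
      = (u x)⁻¹ * (A x v) * u x + (u x)⁻¹ * (fderiv ℝ u x v) := by
  intro x v
  have hgd : ∀ y, IsUnit (γ y).det := fun y => (Matrix.isUnit_iff_isUnit_det _).1 (hγunit y)
  have hinv : DifferentiableAt ℝ (fun y => (γ y)⁻¹) x := by
    have : CompleteSpace (Matrix (Fin m) (Fin m) ℝ) := FiniteDimensional.complete ℝ _
    have h1 : (fun y => (γ y)⁻¹) = fun y => Ring.inverse (γ y) := by
      funext y
      exact Matrix.nonsing_inv_eq_ringInverse _
    rw [h1]
    obtain ⟨g, hg⟩ := hγunit x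
    have h2 := (differentiableAt_inverse (𝕜 := ℝ) (hγunit x))
    exact h2.comp x (hγ x)
  have hw : DifferentiableAt ℝ (fun y => (γ y)⁻¹ * u y) x := hinv.mul (hu x)
  have h3 := (hγ x).hasFDerivAt.mul' hw.hasFDerivAt
  have key := h3.congr_of_eventuallyEq (f₁ := u) (Filter.Eventually.of_forall fun y =>
    (Matrix.mul_nonsing_inv_cancel_left (γ y) (u y) (hgd y)).symm)
  have key2 : fderiv ℝ u x v = γ x * fderiv ℝ (fun y => (γ y)⁻¹ * u y) x v
      + fderiv ℝ γ x v * ((γ x)⁻¹ * u x) := by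
    exact congrArg (fun L : E →L[ℝ] Matrix (Fin m) (Fin m) ℝ => L v) key.fderiv
  rw [key2, Matrix.mul_inv_rev, Matrix.nonsing_inv_nonsing_inv _ (hgd x)]
  generalize fderiv ℝ (fun y => (γ y)⁻¹ * u y) x v = W
  generalize fderiv ℝ γ x v = G
  generalize A x v = a
  have e1 : ∀ M, γ x * ((γ x)⁻¹ * M) = M := fun M =>
    Matrix.mul_nonsing_inv_cancel_left (γ x) M (hgd x)
  simp only [mul_add, add_mul, mul_assoc, e1]
  abel
end

section
/- Let A : E → (E →L[ℝ] M_m) be a continuously differentiable gauge potential and u : E → M_m twice continuously differentiable with u(x) invertible for every x and with x ↦ (u x)⁻¹ twice continuously differentiable. Then the dressed potential Â satisfies the structure equation with the dressed curvature: F_Â(x)(v,w) = (u x)⁻¹ * F_A(x)(v,w) * (u x) for all x, v, w; i.e. the curvature of the dressed potential equals the dressed curvature F̂ := u⁻¹ F u. -/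
attribute [local instance] Matrix.linftyOpNormedRing Matrix.linftyOpNormedAlgebra

/-- The operator norm on `E →L[ℝ] M_m` (Mathlib's `ContinuousLinearMap.toNormedAddCommGroup` for the
norm above), which instance search no longer finds by itself. -/
noncomputable abbrev clmMatrixNormedAddCommGroup
    {E : Type*} [NormedAddCommGroup E] [NormedSpace ℝ E] {m : ℕ} :
    NormedAddCommGroup (E →L[ℝ] Matrix (Fin m) (Fin m) ℝ) :=
  @ContinuousLinearMap.toNormedAddCommGroup ℝ ℝ E (Matrix (Fin m) (Fin m) ℝ) _
    NonUnitalNormedRing.toNormedAddCommGroup _ _ _ (NormedAlgebra.toNormedSpace _) (RingHom.id ℝ) _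

attribute [local instance] clmMatrixNormedAddCommGroup

/-- The normed space structure that goes with it (Mathlib's `ContinuousLinearMap.toNormedSpace`). -/
noncomputable abbrev clmMatrixNormedSpace
    {E : Type*} [NormedAddCommGroup E] [NormedSpace ℝ E] {m : ℕ} :
    NormedSpace ℝ (E →L[ℝ] Matrix (Fin m) (Fin m) ℝ) :=
  @ContinuousLinearMap.toNormedSpace ℝ ℝ E (Matrix (Fin m) (Fin m) ℝ) _
    NonUnitalNormedRing.toNormedAddCommGroup.toSeminormedAddCommGroup _ _ _
    (NormedAlgebra.toNormedSpace _) (RingHom.id ℝ) _ ℝ _ (NormedAlgebra.toNormedSpace _) _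

attribute [local instance] clmMatrixNormedSpace

theorem dressed_aux {E R : Type*} [NormedAddCommGroup E] [NormedSpace ℝ E]
    [NormedRing R] [NormedAlgebra ℝ R]
    (A : E → (E →L[ℝ] R)) (hA : ContDiff ℝ 1 A) (u g : E → R)
    (hu : ContDiff ℝ 2 u) (hg : ContDiff ℝ 2 g)
    (hug : ∀ x, u x * g x = 1) (hgu : ∀ x, g x * u x = 1)
    (B : E → (E →L[ℝ] R))
    (hB : ∀ x v, B x v = g x * (A x v) * u x + g x * (fderiv ℝ u x v)) (x v w : E) :
      (fderiv ℝ B x v) w - (fderiv ℝ B x w) v + (B x v) * (B x w) - (B x w) * (B x v)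
        = g x *
            ((fderiv ℝ A x v) w - (fderiv ℝ A x w) v + (A x v) * (A x w) - (A x w) * (A x v))
          * u x := by
  have dA : DifferentiableAt ℝ A x := (hA.differentiable (by norm_num)) x
  have du : DifferentiableAt ℝ u x := (hu.differentiable (by norm_num)) x
  have dg : DifferentiableAt ℝ g x := (hg.differentiable (by norm_num)) x
  have ddu : DifferentiableAt ℝ (fderiv ℝ u) x :=
    ((hu.fderiv_right (m := 1) (by norm_num)).differentiable (by norm_num)) x
  have dB : DifferentiableAt ℝ B x := by
    have e : B = fun y => ((ContinuousLinearMap.mul ℝ R).flip (u y)).comp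
        ((ContinuousLinearMap.mul ℝ R (g y)).comp (A y))
        + (ContinuousLinearMap.mul ℝ R (g y)).comp (fderiv ℝ u y) := by
      funext y
      ext z
      simp [hB]
    rw [e]
    have h1 : DifferentiableAt ℝ (fun y => ContinuousLinearMap.mul ℝ R (g y)) x :=
      (ContinuousLinearMap.mul ℝ R).differentiableAt.comp x dg
    have h2 : DifferentiableAt ℝ (fun y => (ContinuousLinearMap.mul ℝ R).flip (u y)) x :=
      (ContinuousLinearMap.mul ℝ R).flip.differentiableAt.comp x du
    exact (h2.clm_comp (h1.clm_comp dA)).add (h1.clm_comp ddu)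
  have ev : ∀ (C : E → (E →L[ℝ] R)), DifferentiableAt ℝ C x → ∀ b,
      HasFDerivAt (fun y => C y b) ((fderiv ℝ C x).flip b) x := by
    intro C hC b
    have := hC.hasFDerivAt.clm_apply (hasFDerivAt_const b x)
    simpa using this
  have key : ∀ a b, (fderiv ℝ B x a) b =
      (fderiv ℝ g x a) * A x b * u x + g x * (fderiv ℝ A x a b) * u x
      + g x * A x b * fderiv ℝ u x a + (fderiv ℝ g x a) * fderiv ℝ u x b
      + g x * (fderiv ℝ (fderiv ℝ u) x a b) := by
    intro a b
    have h1 := ev B dB b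
    have h2 := ((dg.hasFDerivAt.mul' (ev A dA b)).mul' du.hasFDerivAt).add
      (dg.hasFDerivAt.mul' (ev _ ddu b))
    have h3 : (fun y => B y b) = _ := funext fun y => hB y b
    rw [h3] at h1
    have h4 := congrArg (fun L => L a) (h1.unique h2)
    simp at h4
    rw [h4]
    noncomm_ring
  have hdg : ∀ a, fderiv ℝ g x a = - (g x * fderiv ℝ u x a * g x) := by
    intro a
    have h1 := dg.hasFDerivAt.mul' du.hasFDerivAt
    have h2 : (g * u) = fun _ => (1 : R) := funext hgu
    rw [h2] at h1
    have h4 := congrArg (fun L => L a) (h1.unique (hasFDerivAt_const _ x))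
    simp at h4
    have h5 : fderiv ℝ g x a * u x = - (g x * fderiv ℝ u x a) := by
      rw [eq_neg_iff_add_eq_zero, ← h4]; abel
    calc fderiv ℝ g x a = fderiv ℝ g x a * u x * g x := by rw [mul_assoc, hug, mul_one]
      _ = _ := by rw [h5, neg_mul]
  have sym : fderiv ℝ (fderiv ℝ u) x v w = fderiv ℝ (fderiv ℝ u) x w v :=
    (hu.contDiffAt.isSymmSndFDerivAt (by simp)) v w
  have c : ∀ z, u x * (g x * z) = z := fun z => by rw [← mul_assoc, hug, one_mul]
  rw [key, key, sym, hdg, hdg]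
  simp only [hB, mul_add, add_mul, mul_sub, sub_mul, mul_assoc, c, neg_mul]
  abel

/-- Let `A` be a `C¹` gauge potential and `u : E → M_m` be `C²` with
pointwise invertible values and `C²` pointwise inverse.  Then the curvature of the
dressed potential `Â x v := (u x)⁻¹ * (A x v) * u x + (u x)⁻¹ * fderiv ℝ u x v` equals
the dressed curvature: `F_Â x (v, w) = (u x)⁻¹ * F_A x (v, w) * u x`. -/
theorem dressed_curvature_is_curvature_of_dressed_potential
    {E : Type*} [NormedAddCommGroup E] [NormedSpace ℝ E]
    {m : ℕ} (hm : 0 < m)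
    (A : E → (E →L[ℝ] Matrix (Fin m) (Fin m) ℝ))
    (hA : ContDiff ℝ 1 A)
    (u : E → Matrix (Fin m) (Fin m) ℝ)
    (hu : ContDiff ℝ 2 u)
    (hunit : ∀ x, IsUnit (u x))
    (huinv : ContDiff ℝ 2 (fun y => (u y)⁻¹))
    (Ahat : E → (E →L[ℝ] Matrix (Fin m) (Fin m) ℝ))
    (hAhat : ∀ x v, Ahat x v = (u x)⁻¹ * (A x v) * u x + (u x)⁻¹ * (fderiv ℝ u x v)) :
    ∀ (x v w : E),
      (fderiv ℝ Ahat x v) w - (fderiv ℝ Ahat x w) v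
          + (Ahat x v) * (Ahat x w) - (Ahat x w) * (Ahat x v)
        = (u x)⁻¹ *
            ((fderiv ℝ A x v) w - (fderiv ℝ A x w) v + (A x v) * (A x w) - (A x w) * (A x v))
          * u x := by
  intro x v w
  have hd : ∀ x, IsUnit (u x).det := fun x => (Matrix.isUnit_iff_isUnit_det _).1 (hunit x)
  exact dressed_aux A hA u (fun y => (u y)⁻¹) hu huinv
    (fun x => Matrix.mul_nonsing_inv _ (hd x)) (fun x => Matrix.nonsing_inv_mul _ (hd x))
    Ahat hAhat x v w
end

section
/- Let A : E → (E →L[ℝ] M_m) be a gauge potential, u : E → M_m differentiable with u(x) invertible for every x and with x ↦ (u x)⁻¹ differentiable, and ψ : E → (Fin m → ℝ) a differentiable map. Define the dressed matter field ψ̂(x) := (u x)⁻¹ ⬝ᵥ applied as matrix-vector multiplication, ψ̂(x) := ((u x)⁻¹).mulVec (ψ x). Then the dressed covariant derivative identity holds: ((u x)⁻¹).mulVec (fderiv ℝ ψ x v + (A x v).mulVec (ψ x)) = fderiv ℝ ψ̂ x v + (Â x v).mulVec (ψ̂ x) for all x, v, where Â is the dressing of A by u. -/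
attribute [local instance] Matrix.linftyOpNormedRing Matrix.linftyOpNormedAlgebra

theorem mulVec_isBdd (m : ℕ) : IsBoundedBilinearMap ℝ
    (fun p : Matrix (Fin m) (Fin m) ℝ × (Fin m → ℝ) => p.1.mulVec p.2) where
  add_left := fun a b c => Matrix.add_mulVec a b c
  smul_left := fun c a b => Matrix.smul_mulVec c a b
  add_right := fun a b c => Matrix.mulVec_add a b c
  smul_right := fun c a b => Matrix.mulVec_smul a c b
  bound := ⟨1, one_pos, fun a b => by
    rw [one_mul]; exact Matrix.linfty_opNorm_mulVec a b⟩

theorem fderiv_mulVec_aux {E : Type*} [NormedAddCommGroup E] [NormedSpace ℝ E] {m : ℕ}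
    (g : E → Matrix (Fin m) (Fin m) ℝ) (f : E → (Fin m → ℝ)) (x v : E)
    (hg : DifferentiableAt ℝ g x) (hf : DifferentiableAt ℝ f x) :
    DifferentiableAt ℝ (fun y => (g y).mulVec (f y)) x ∧
    fderiv ℝ (fun y => (g y).mulVec (f y)) x v
      = (g x).mulVec (fderiv ℝ f x v) + (fderiv ℝ g x v).mulVec (f x) := by
  have h := ((mulVec_isBdd m).hasFDerivAt (g x, f x)).comp x
    (hg.hasFDerivAt.prodMk hf.hasFDerivAt)
  refine ⟨h.differentiableAt, ?_⟩
  have h2 := congrArg (fun L => L v) h.fderiv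
  exact h2

/-- Let `A` be a gauge potential, `u : E → M_m` differentiable with
pointwise invertible values and differentiable pointwise inverse, and
`ψ : E → (Fin m → ℝ)` differentiable.  With the dressed matter field
`ψ̂ x := ((u x)⁻¹).mulVec (ψ x)` and the dressed potential
`Â x v := (u x)⁻¹ * (A x v) * u x + (u x)⁻¹ * fderiv ℝ u x v`, the dressed covariant
derivative identity holds:
`((u x)⁻¹).mulVec (Dψ) = fderiv ℝ ψ̂ x v + (Â x v).mulVec (ψ̂ x)`. -/
theorem dressed_covariant_derivative
    {E : Type*} [NormedAddCommGroup E] [NormedSpace ℝ E]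
    {m : ℕ} (hm : 0 < m)
    (A : E → (E →L[ℝ] Matrix (Fin m) (Fin m) ℝ))
    (u : E → Matrix (Fin m) (Fin m) ℝ)
    (hu : Differentiable ℝ u)
    (hunit : ∀ x, IsUnit (u x))
    (huinv : Differentiable ℝ (fun y => (u y)⁻¹))
    (ψ : E → (Fin m → ℝ))
    (hψ : Differentiable ℝ ψ) :
    ∀ (x v : E),
      ((u x)⁻¹).mulVec (fderiv ℝ ψ x v + (A x v).mulVec (ψ x))
        = fderiv ℝ (fun y => ((u y)⁻¹).mulVec (ψ y)) x v
          + ((u x)⁻¹ * (A x v) * u x + (u x)⁻¹ * (fderiv ℝ u x v)).mulVec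
              (((u x)⁻¹).mulVec (ψ x)) := by
  intro x v
  have hdet : ∀ y, IsUnit (u y).det := fun y => (Matrix.isUnit_iff_isUnit_det _).1 (hunit y)
  have h1 := (fderiv_mulVec_aux (fun y => (u y)⁻¹) ψ x v (huinv x) (hψ x)).1
  have h2 := (fderiv_mulVec_aux u (fun y => ((u y)⁻¹).mulVec (ψ y)) x v (hu x) h1).2
  have h3 : (fun y => (u y).mulVec (((u y)⁻¹).mulVec (ψ y))) = ψ := by
    funext y
    rw [Matrix.mulVec_mulVec, Matrix.mul_nonsing_inv _ (hdet y), Matrix.one_mulVec]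
  have h4 : (u x).mulVec (((u x)⁻¹).mulVec (ψ x)) = ψ x := congrFun h3 x
  rw [h3] at h2
  rw [h2, Matrix.add_mulVec, Matrix.mulVec_add, Matrix.mulVec_add, ← Matrix.mulVec_mulVec,
    h4, Matrix.mulVec_mulVec, Matrix.nonsing_inv_mul _ (hdet x), Matrix.one_mulVec,
    ← Matrix.mulVec_mulVec, ← Matrix.mulVec_mulVec]
  abel
end
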